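/- Let n ≥ 1 and f ∈ C²(ℝ₊,ℝ). If the function C ↦ f(det C) is convex on the set PSym(n) of real symmetric positive definite n×n matrices, then f''(s) ≥ −((n−1)/n)·(f'(s)/s) for all s > 0. -/

import Mathlib

open Matrix

/-- Restricting a convex function of the determinant to positive multiples of the identity. -/
theorem convexOn_comp_pow_of_convexOn_det {n : ℕ} {f : ℝ → ℝ}
    (hconv : ConvexOn ℝ {C : Matrix (Fin n) (Fin n) ℝ | C.PosDef} (fun C => f C.det)) :
    ConvexOn ℝ (Set.Ioi 0) (fun t : ℝ => f (t ^ n)) := by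
  refine ⟨convex_Ioi 0, fun x hx y hy a b ha hb hab => ?_⟩
  have h := hconv.2 (x := x • 1) (y := y • 1) (PosDef.one.smul hx) (PosDef.one.smul hy) ha hb hab
  simpa only [smul_smul, ← add_smul, det_smul, det_one, mul_one, Fintype.card_fin,
    smul_eq_mul] using h

theorem second_deriv_lower_bound_of_convexOn (n : ℕ) (hn : 1 ≤ n) (f : ℝ → ℝ)
    (hf : ContDiffOn ℝ 2 f (Set.Ioi 0))
    (hconv : ConvexOn ℝ {C : Matrix (Fin n) (Fin n) ℝ | C.PosDef} (fun C => f C.det)) :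
    ∀ s : ℝ, 0 < s →
      -(((n : ℝ) - 1) / (n : ℝ)) * (deriv f s / s) ≤ deriv (deriv f) s := by
  intro s hs
  have hf₁ : ∀ x : ℝ, 0 < x → HasDerivAt f (deriv f x) x := fun x hx =>
    ((hf.contDiffAt (Ioi_mem_nhds hx)).differentiableAt (by norm_num)).hasDerivAt
  have hf₂ : HasDerivAt (deriv f) (deriv (deriv f) s) s :=
    (((hf.deriv_of_isOpen (m := 1) isOpen_Ioi (by norm_num)).contDiffAt
      (Ioi_mem_nhds hs)).differentiableAt (by norm_num)).hasDerivAt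
  obtain ⟨m, rfl⟩ := Nat.exists_eq_add_of_le' hn
  obtain ⟨t, ht, rfl⟩ : ∃ t : ℝ, 0 < t ∧ t ^ (m + 1) = s :=
    ⟨s ^ ((m + 1 : ℕ) : ℝ)⁻¹, Real.rpow_pos_of_pos hs _,
      Real.rpow_inv_natCast_pow hs.le m.succ_ne_zero⟩
  have hderiv : ∀ x : ℝ, 0 < x → HasDerivAt (fun x : ℝ => f (x ^ (m + 1)))
      (deriv f (x ^ (m + 1)) * (((m + 1 : ℕ) : ℝ) * x ^ m)) x := fun x hx =>
    (hf₁ _ (pow_pos hx _)).comp x (hasDerivAt_pow (m + 1) x)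
  have hmono := (convexOn_comp_pow_of_convexOn_det hconv).monotoneOn_deriv
    fun x hx => (hderiv x hx).differentiableAt
  have hcomp : HasDerivAt (fun x : ℝ => deriv f (x ^ (m + 1)))
      (deriv (deriv f) (t ^ (m + 1)) * (((m + 1 : ℕ) : ℝ) * t ^ m)) t :=
    HasDerivAt.comp (h := fun x : ℝ => x ^ (m + 1)) t hf₂ (hasDerivAt_pow (m + 1) t)
  have hderiv₂ := (hcomp.mul ((hasDerivAt_pow m t).const_mul ((m + 1 : ℕ) : ℝ)))
    |>.congr_of_eventuallyEq (f₁ := deriv fun x : ℝ => f (x ^ (m + 1))) (by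
      filter_upwards [Ioi_mem_nhds ht] with x hx using (hderiv x hx).deriv)
  have hnonneg := hmono.derivWithin_nonneg (x := t)
  rw [derivWithin_of_isOpen isOpen_Ioi ht, hderiv₂.deriv] at hnonneg
  have hpow : (m : ℝ) * t ^ (m - 1) * t = m * t ^ m := by
    cases m with
    | zero => simp
    | succ k => simp [pow_succ, mul_assoc]
  generalize deriv f (t ^ (m + 1)) = D at hnonneg ⊢
  generalize deriv (deriv f) (t ^ (m + 1)) = E at hnonneg ⊢
  have hprod : 0 ≤ (E * (((m : ℝ) + 1) * t ^ (m + 1)) + D * m) * ((m + 1) * t ^ m) := by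
    have h := mul_nonneg hnonneg ht.le
    push_cast at h
    refine h.trans_eq ?_
    linear_combination D * (m + 1) * hpow
  have hsum := nonneg_of_mul_nonneg_left hprod (by positivity)
  have hcoef : 0 < ((m : ℝ) + 1) * t ^ (m + 1) := by positivity
  have hkey : -(D * m) / ((m + 1) * t ^ (m + 1)) ≤ E := by
    rw [div_le_iff₀ hcoef]
    linarith
  refine le_trans (le_of_eq ?_) hkey
  push_cast
  field_simp
  ring
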